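/- There exist a finite undirected graph G with a source s and a destination t and a source-matched forwarding scheme Π for (s,t) such that Π is 2-resilient against static failures but Π is not 2-resilient against semi-dynamic failures, while G admits another source-matched forwarding scheme for (s,t) that is 2-resilient against semi-dynamic failures. -/

import Mathlib

namespace FRR

open scoped Classical

variable {V : Type*} [Fintype V] [DecidableEq V]

/-- `G` is `k`-edge-connected: removing any set of at most `k-1` edges keeps it connected. -/
def EdgeConnected (G : SimpleGraph V) (k : ℕ) : Prop :=
  ∀ F : Set (Sym2 V), F ⊆ G.edgeSet → F.ncard ≤ k - 1 → (G.deleteEdges F).Connected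


/-- A (basic, deterministic) forwarding scheme on `G`: given the current node, the
in-port (the neighbor the packet arrived from, `none` for a freshly originated packet)
and the set of currently active neighbors, it selects an active neighbor to forward to. -/
structure FwdScheme (G : SimpleGraph V) where
  fwd : V → Option V → Set V → V
  mem : ∀ (v : V) (ip : Option V) (A : Set V), A.Nonempty → fwd v ip A ∈ A

/-- The packet trajectory (current node, in-port) of a forwarding scheme with
destination `t`, started at `s`, under the failure schedule `σ`; the packet is
absorbed at `t` and gets stuck when no incident link is active. -/
noncomputable def FwdScheme.traj {G : SimpleGraph V} (P : FwdScheme G)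
    (σ : ℕ → Set (Sym2 V)) (t s : V) : ℕ → V × Option V
  | 0 => (s, none)
  | n + 1 =>
    let p := FwdScheme.traj P σ t s n
    if p.1 = t then p
    else if ({u : V | G.Adj p.1 u ∧ s(p.1, u) ∉ σ n} : Set V).Nonempty then
      (P.fwd p.1 p.2 {u : V | G.Adj p.1 u ∧ s(p.1, u) ∉ σ n}, some p.1)
    else p

/-- A forwarding scheme for destination `t` is `r`-resilient against dynamic failures:
for every unstable-link set `F` with `|F| ≤ r`, every (dynamic, i.e. arbitrary) failure
schedule `σ` on `F` whose induced trajectory satisfies the non-trap assumption, and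
every source `s` connected to `t` in `G ∖ F`, the packet reaches `t` in finitely
many steps. -/
def DynResilient {G : SimpleGraph V} (P : FwdScheme G) (t : V) (r : ℕ) : Prop :=
  ∀ F : Set (Sym2 V), F ⊆ G.edgeSet → F.ncard ≤ r →
    ∀ σ : ℕ → Set (Sym2 V), (∀ n, σ n ⊆ F) →
      ∀ s : V,
        (∀ n, (G.deleteEdges F).Reachable (P.traj σ t s n).1 (P.traj σ t s (n + 1)).1) →
        (G.deleteEdges F).Reachable s t →
        ∃ n, (P.traj σ t s n).1 = t

/-- A source-matched forwarding scheme `P` for the pair `(s, t)` is `r`-resilient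
against static failures: for every `F ⊆ E` with `|F| ≤ r` such that `s` and `t` are
connected in `G ∖ F`, and every static schedule on `F` (all links of `F` down at all
times) whose trajectory satisfies the non-trap assumption, the packet originated at
`s` reaches `t` after finitely many steps. -/
def SrcStaticResilient {G : SimpleGraph V} (P : FwdScheme G) (s t : V) (r : ℕ) : Prop :=
  ∀ F : Set (Sym2 V), F ⊆ G.edgeSet → F.ncard ≤ r →
    (G.deleteEdges F).Reachable s t →
    ∀ σ : ℕ → Set (Sym2 V), (∀ n, σ n = F) →
      (∀ n, (G.deleteEdges F).Reachable (P.traj σ t s n).1 (P.traj σ t s (n + 1)).1) →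
      ∃ n, (P.traj σ t s n).1 = t

/-- A source-matched forwarding scheme `P` for the pair `(s, t)` is `r`-resilient
against semi-dynamic failures: for every `F ⊆ E` with `|F| ≤ r` such that `s` and `t`
are connected in `G ∖ F`, and every semi-dynamic (monotone) schedule `σ` on `F` whose
trajectory satisfies the non-trap assumption, the packet originated at `s` reaches `t`
after finitely many steps. -/
def SrcSemiDynResilient {G : SimpleGraph V} (P : FwdScheme G) (s t : V) (r : ℕ) : Prop :=
  ∀ F : Set (Sym2 V), F ⊆ G.edgeSet → F.ncard ≤ r →
    (G.deleteEdges F).Reachable s t →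
    ∀ σ : ℕ → Set (Sym2 V), (∀ n, σ n ⊆ F) → (∀ n, σ n ⊆ σ (n + 1)) →
      (∀ n, (G.deleteEdges F).Reachable (P.traj σ t s n).1 (P.traj σ t s (n + 1)).1) →
      ∃ n, (P.traj σ t s n).1 = t

/-! Vertices: `s = 0`, `x = 1`, `c = 2`, `t = 3`; all pairs are adjacent except `c, t`. -/

/-- The counterexample graph. -/
def gr : SimpleGraph (Fin 4) where
  Adj a b := a ≠ b ∧ a.val + b.val ≠ 5
  symm := ⟨fun a b h => ⟨h.1.symm, by have := h.2; omega⟩⟩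
  loopless := ⟨fun _ h => h.1 rfl⟩

/-- The first element of a priority list that lies in `A` (some element of `A` otherwise). -/
noncomputable def pick (A : Set (Fin 4)) : List (Fin 4) → Fin 4
  | [] => if h : A.Nonempty then h.some else 0
  | a :: l => if a ∈ A then a else pick A l

lemma pick_mem (A : Set (Fin 4)) (h : A.Nonempty) (l : List (Fin 4)) : pick A l ∈ A := by
  induction l with
  | nil => simp only [pick, dif_pos h]; exact h.some_mem
  | cons a l ih =>
    unfold pick
    split_ifs with ha
    · exact ha
    · exact ih

/-- Priorities of the statically resilient scheme; `b` says whether the link to `x` is active. -/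
def prio (v : Fin 4) (ip : Option (Fin 4)) (b : Prop) [Decidable b] : List (Fin 4) :=
  if v = 0 then
    if ip = none then [1, 3, 2]
    else if ip = some 1 then [3, 2, 1]
    else if b then [3, 1, 2] else [2, 3]
  else if v = 1 then
    if ip = some 2 then [3, 0, 2] else [3, 2, 0]
  else
    if ip = some 1 then [0, 1] else [1, 0]

/-- The statically resilient scheme. -/
noncomputable def schemeA : FwdScheme gr where
  fwd v ip A := pick A (prio v ip (1 ∈ A))
  mem _ _ A h := pick_mem A h _

/-- The semi-dynamically resilient scheme. -/
noncomputable def schemeB : FwdScheme gr where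
  fwd v _ A := pick A (if v = 0 then [3, 1, 2] else if v = 1 then [3, 0, 2] else [1, 0])
  mem _ _ A h := pick_mem A h _

lemma traj_step {P : FwdScheme gr} {σ : ℕ → Set (Sym2 (Fin 4))} {n : ℕ} {v : Fin 4}
    {ip : Option (Fin 4)} (u : Fin 4) (h : P.traj σ 3 0 n = (v, ip)) (hv : v ≠ 3)
    (ha : gr.Adj v u) (hu : s(v, u) ∉ σ n)
    (hf : P.fwd v ip {u | gr.Adj v u ∧ s(v, u) ∉ σ n} = u) :
    P.traj σ 3 0 (n + 1) = (u, some v) := by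
  have hne : ({u : Fin 4 | gr.Adj v u ∧ s(v, u) ∉ σ n} : Set (Fin 4)).Nonempty := ⟨u, ha, hu⟩
  simp only [FwdScheme.traj, h, if_neg hv, if_pos hne, hf]

lemma three_not {F : Set (Sym2 (Fin 4))} (hF : F.ncard ≤ 2) {a b c : Sym2 (Fin 4)}
    (ha : a ∈ F) (hb : b ∈ F) (hc : c ∈ F) (hab : a ≠ b) (hac : a ≠ c) (hbc : b ≠ c) :
    False := by
  have h3 : ({a, b, c} : Set (Sym2 (Fin 4))).ncard = 3 := Set.ncard_eq_three.2
    ⟨a, b, c, hab, hac, hbc, rfl⟩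
  have hs : ({a, b, c} : Set (Sym2 (Fin 4))) ⊆ F := by
    rintro y (rfl | rfl | rfl) <;> assumption
  have := Set.ncard_le_ncard hs (Set.toFinite F)
  omega

lemma t_link {F : Set (Sym2 (Fin 4))} (h : (gr.deleteEdges F).Reachable 0 3) :
    s(0, 3) ∉ F ∨ s(1, 3) ∉ F := by
  obtain ⟨w⟩ := h.symm
  cases w with
  | cons hadj w =>
    rename_i v; clear w
    rw [SimpleGraph.deleteEdges_adj] at hadj
    obtain ⟨⟨h1, h2⟩, h3⟩ := hadj
    rw [Sym2.eq_swap] at h3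
    fin_cases v
    · exact Or.inl h3
    · exact Or.inr h3
    · exact absurd rfl h2
    · exact absurd rfl h1

lemma static_A : SrcStaticResilient schemeA 0 3 2 := by
  intro F _ hF hr σ hσ _
  obtain rfl : σ = fun _ => F := funext hσ
  have ht := t_link hr
  have h0 : schemeA.traj (fun _ => F) 3 0 0 = (0, none) := rfl
  by_cases h01 : s(0, 1) ∈ F
  · by_cases h03 : s(0, 3) ∈ F
    · have h02 : s(0, 2) ∉ F := fun h => three_not hF h01 h03 h (by decide) (by decide) (by decide)
      have h12 : s(2, 1) ∉ F := fun h => three_not hF h01 h03 h (by decide) (by decide) (by decide)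
      have h13 : s(1, 3) ∉ F := fun h => three_not hF h01 h03 h (by decide) (by decide) (by decide)
      have h1 := traj_step 2 h0 (by decide) (by simp [gr]) h02
        (by simp [schemeA, prio, pick, gr, *])
      have h2 := traj_step 1 h1 (by decide) (by simp [gr]) h12
        (by simp [schemeA, prio, pick, gr, *])
      have h3 := traj_step 3 h2 (by decide) (by simp [gr]) h13
        (by simp [schemeA, prio, pick, gr, *])
      exact ⟨_, congrArg Prod.fst h3⟩
    · have h1 := traj_step 3 h0 (by decide) (by simp [gr]) h03
        (by simp [schemeA, prio, pick, gr, *])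
      exact ⟨_, congrArg Prod.fst h1⟩
  · have h1 := traj_step 1 h0 (by decide) (by simp [gr]) h01
        (by simp [schemeA, prio, pick, gr, *])
    by_cases h13 : s(1, 3) ∈ F
    · have h03 : s(0, 3) ∉ F := by tauto
      have h10 : s(1, 0) ∉ F := by rwa [Sym2.eq_swap]
      by_cases h12 : s(1, 2) ∈ F
      · have h2 := traj_step 0 h1 (by decide) (by simp [gr]) h10
          (by simp [schemeA, prio, pick, gr, *])
        have h3 := traj_step 3 h2 (by decide) (by simp [gr]) h03
          (by simp [schemeA, prio, pick, gr, *])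
        exact ⟨_, congrArg Prod.fst h3⟩
      · have h2 := traj_step 2 h1 (by decide) (by simp [gr]) h12
          (by simp [schemeA, prio, pick, gr, *])
        by_cases h20 : s(2, 0) ∈ F
        · have h21 : s(2, 1) ∉ F := by rwa [Sym2.eq_swap]
          have h3 := traj_step 1 h2 (by decide) (by simp [gr]) h21
            (by simp [schemeA, prio, pick, gr, *])
          have h4 := traj_step 0 h3 (by decide) (by simp [gr]) h10
            (by simp [schemeA, prio, pick, gr, *])
          have h5 := traj_step 3 h4 (by decide) (by simp [gr]) h03
            (by simp [schemeA, prio, pick, gr, *])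
          exact ⟨_, congrArg Prod.fst h5⟩
        · have h3 := traj_step 0 h2 (by decide) (by simp [gr]) h20
            (by simp [schemeA, prio, pick, gr, *])
          have h4 := traj_step 3 h3 (by decide) (by simp [gr]) h03
            (by simp [schemeA, prio, pick, gr, *])
          exact ⟨_, congrArg Prod.fst h4⟩
    · have h2 := traj_step 3 h1 (by decide) (by simp [gr]) h13
        (by simp [schemeA, prio, pick, gr, *])
      exact ⟨_, congrArg Prod.fst h2⟩

lemma semi_B : SrcSemiDynResilient schemeB 0 3 2 := by
  intro F _ hF hr σ hσ hm _
  have ht := t_link hr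
  have h0 : schemeB.traj σ 3 0 0 = (0, none) := rfl
  by_cases h03 : s(0, 3) ∈ σ 0
  · have h13 : ∀ n, s(1, 3) ∉ σ n := by
      intro n h
      have := hσ _ h
      have := hσ _ h03
      tauto
    by_cases h01 : s(0, 1) ∈ σ 0
    · have h02 : s(0, 2) ∉ σ 0 := fun h =>
        three_not hF (hσ _ h01) (hσ _ h03) (hσ _ h) (by decide) (by decide) (by decide)
      have h12 : s(2, 1) ∉ σ (0 + 1) := fun h =>
        three_not hF (hσ _ h01) (hσ _ h03) (hσ _ h) (by decide) (by decide) (by decide)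
      have h1 := traj_step 2 h0 (by decide) (by simp [gr]) h02
        (by simp [schemeB, pick, gr, *])
      have h2 := traj_step 1 h1 (by decide) (by simp [gr]) h12
        (by simp at h12; simp [schemeB, pick, gr, *])
      have h3 := traj_step 3 h2 (by decide) (by simp [gr]) (h13 _)
        (by simp [schemeB, pick, gr, *])
      exact ⟨_, congrArg Prod.fst h3⟩
    · have h1 := traj_step 1 h0 (by decide) (by simp [gr]) h01
        (by simp [schemeB, pick, gr, *])
      have h2 := traj_step 3 h1 (by decide) (by simp [gr]) (h13 _)
        (by simp [schemeB, pick, gr, *])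
      exact ⟨_, congrArg Prod.fst h2⟩
  · have h1 := traj_step 3 h0 (by decide) (by simp [gr]) h03
      (by simp [schemeB, pick, gr, *])
    exact ⟨_, congrArg Prod.fst h1⟩

/-- The bad semi-dynamic schedule: `x t` is down from the start, `s x` fails after one step. -/
def bad : ℕ → Set (Sym2 (Fin 4))
  | 0 => {s(1, 3)}
  | _ + 1 => {s(1, 3), s(0, 1)}

lemma bad_traj (n : ℕ) :
    schemeA.traj bad 3 0 (n + 1) = (1, some 0) ∨ schemeA.traj bad 3 0 (n + 1) = (2, some 1) ∨
    schemeA.traj bad 3 0 (n + 1) = (0, some 2) ∨ schemeA.traj bad 3 0 (n + 1) = (2, some 0) ∨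
    schemeA.traj bad 3 0 (n + 1) = (1, some 2) := by
  induction n with
  | zero =>
    left
    have h0 : schemeA.traj bad 3 0 0 = (0, none) := rfl
    exact traj_step 1 h0 (by decide) (by simp [gr]) (by simp [bad])
      (by simp [schemeA, prio, pick, gr, bad])
  | succ n ih =>
    rcases ih with h | h | h | h | h
    · have := traj_step 2 h (by decide) (by simp [gr]) (by simp [bad])
        (by simp [schemeA, prio, pick, gr, bad])
      tauto
    · have := traj_step 0 h (by decide) (by simp [gr]) (by simp [bad])
        (by simp [schemeA, prio, pick, gr, bad])
      tauto
    · have := traj_step 2 h (by decide) (by simp [gr]) (by simp [bad])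
        (by simp [schemeA, prio, pick, gr, bad])
      tauto
    · have := traj_step 1 h (by decide) (by simp [gr]) (by simp [bad])
        (by simp [schemeA, prio, pick, gr, bad])
      tauto
    · have := traj_step 2 h (by decide) (by simp [gr]) (by simp [bad])
        (by simp [schemeA, prio, pick, gr, bad])
      tauto

lemma not_semi_A : ¬ SrcSemiDynResilient schemeA 0 3 2 := by
  intro H
  have r02 : (gr.deleteEdges {s(1, 3), s(0, 1)}).Reachable 0 2 :=
    SimpleGraph.Adj.reachable (by simp [gr])
  have r03 : (gr.deleteEdges {s(1, 3), s(0, 1)}).Reachable 0 3 :=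
    SimpleGraph.Adj.reachable (by simp [gr])
  have r21 : (gr.deleteEdges {s(1, 3), s(0, 1)}).Reachable 2 1 :=
    SimpleGraph.Adj.reachable (by simp [gr])
  have rall : ∀ v, (gr.deleteEdges {s(1, 3), s(0, 1)}).Reachable 0 v := by
    intro v
    fin_cases v
    · exact SimpleGraph.Reachable.refl _
    · exact r02.trans r21
    · exact r02
    · exact r03
  obtain ⟨n, hn⟩ := H {s(1, 3), s(0, 1)}
    (by rintro e (rfl | rfl) <;> simp [gr])
    (Set.ncard_insert_le _ _ |>.trans (by simp)) r03 bad
    (by intro n; cases n <;> simp [bad])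
    (by intro n; cases n <;> simp [bad])
    (fun n => (rall _).symm.trans (rall _))
  cases n with
  | zero => exact absurd hn (by simp [FwdScheme.traj])
  | succ n => rcases bad_traj n with h | h | h | h | h <;> simp [h] at hn

/-- Theorem (static 2-resilience does not transfer to semi-dynamic failures): there
exist a finite graph `G` with a source `s` and a destination `t` and a source-matched
forwarding scheme `P` for `(s, t)` such that `P` is 2-resilient against static
failures but not 2-resilient against semi-dynamic failures, while `G` admits another
source-matched forwarding scheme for `(s, t)` that is 2-resilient against
semi-dynamic failures. -/
theorem static_two_resilience_not_semidynamic :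
    ∃ (N : ℕ) (G : SimpleGraph (Fin N)) (s t : Fin N) (P : FwdScheme G),
      SrcStaticResilient P s t 2 ∧
      ¬ SrcSemiDynResilient P s t 2 ∧
      ∃ P' : FwdScheme G, SrcSemiDynResilient P' s t 2 := by
  exact ⟨4, gr, 0, 3, schemeA, static_A, not_semi_A, schemeB, semi_B⟩

end FRR
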